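/- Let f : ℝ^m → ℝ^m be continuous and suppose there exists r > 0 such that ⟨f(c), c⟩ ≥ 0 for all c with ‖c‖ = r. Then there exists c₀ with ‖c₀‖ ≤ r such that f(c₀) = 0. -/

import Mathlib

open scoped RealInnerProductSpace

open Metric Set MeasureTheory

theorem Matrix.exists_polynomial_eval_eq_det_one_add_smul {n : Type*} [Fintype n] [DecidableEq n]
    (M : Matrix n n ℝ) :
    ∃ p : Polynomial ℝ, p.natDegree ≤ Fintype.card n ∧
      ∀ t : ℝ, p.eval t = (1 + t • M).det := by
  refine ⟨((Polynomial.X : Polynomial ℝ) • M.map Polynomial.C +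
    (1 : Matrix n n ℝ).map Polynomial.C).det, Polynomial.natDegree_det_X_add_C_le M 1, fun t ↦ ?_⟩
  rw [← Polynomial.coe_evalRingHom, RingHom.map_det]
  congr 1
  ext i j
  obtain rfl | hij := eq_or_ne i j
  · simp
    ring
  · simp [hij]
    ring

section Interpolation

variable {E : Type*} [NormedAddCommGroup E] [NormedSpace ℝ E] [FiniteDimensional ℝ E]

theorem exists_polynomial_eval_eq_det_one_add_smul (A : E →L[ℝ] E) :
    ∃ p : Polynomial ℝ, p.natDegree ≤ Module.finrank ℝ E ∧
      ∀ t : ℝ, p.eval t = (1 + t • A).det := by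
  have b := Module.finBasis ℝ E
  obtain ⟨p, hdeg, hp⟩ :=
    (LinearMap.toMatrix b b (A : E →ₗ[ℝ] E)).exists_polynomial_eval_eq_det_one_add_smul
  refine ⟨p, by simpa using hdeg, fun t ↦ ?_⟩
  rw [hp, ← LinearMap.toMatrix_one b, ← map_smul, ← map_add, LinearMap.det_toMatrix]
  rfl

/-- The values of `t ↦ det (1 + t • A)` at finitely many arbitrarily small positive nodes determine
its value at `1`, through weights that do not depend on `A`. -/
theorem exists_weights_det_one_add {δ : ℝ} (hδ : 0 < δ) :
    ∃ (s : Finset ℝ) (w : ℝ → ℝ), (∀ t ∈ s, 0 < t ∧ t ≤ δ) ∧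
      ∀ A : E →L[ℝ] E, (1 + A).det = ∑ t ∈ s, w t * (1 + t • A).det := by
  obtain ⟨s, hs, hcard⟩ := (Ioc_infinite hδ).exists_subset_card_eq (Module.finrank ℝ E + 1)
  refine ⟨s, fun t ↦ (Lagrange.basis s id t).eval 1, fun t ht ↦ hs ht, fun A ↦ ?_⟩
  obtain ⟨p, hdeg, hp⟩ := exists_polynomial_eval_eq_det_one_add_smul A
  have hlt : p.degree < s.card := by
    rw [hcard]
    exact (Polynomial.degree_le_of_natDegree_le hdeg).trans_lt (by norm_cast; omega)
  have h1 := congrArg (Polynomial.eval 1)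
    (Lagrange.eq_interpolate (v := id) (Function.injective_id.injOn) hlt)
  rw [Lagrange.interpolate_apply, Polynomial.eval_finsetSum, hp, one_smul] at h1
  simpa [hp, mul_comm] using h1

theorem det_one_add_pos {A : E →L[ℝ] E} (hA : ‖A‖ < 1) : 0 < (1 + A).det := by
  have hne : ∀ t ∈ Icc (0 : ℝ) 1, (1 + t • A).det ≠ 0 := by
    intro t ht h0
    obtain ⟨v, hv, hv0⟩ := Submodule.exists_mem_ne_zero_of_ne_bot
      (LinearMap.bot_lt_ker_of_det_eq_zero h0).ne'
    have h2 : v = -(t • A v) := by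
      rw [eq_neg_iff_add_eq_zero]
      simpa using hv
    have h3 : ‖v‖ ≤ t * (‖A‖ * ‖v‖) := by
      calc ‖v‖ = ‖-(t • A v)‖ := congrArg _ h2
        _ = t * ‖A v‖ := by rw [norm_neg, norm_smul, Real.norm_of_nonneg ht.1]
        _ ≤ _ := mul_le_mul_of_nonneg_left (A.le_opNorm v) ht.1
    have h4 : 0 < ‖v‖ := norm_pos_iff.2 hv0
    have h5 : t * (‖A‖ * ‖v‖) ≤ 1 * (‖A‖ * ‖v‖) :=
      mul_le_mul_of_nonneg_right ht.2 (by positivity)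
    nlinarith
  have hcont : ContinuousOn (fun t : ℝ ↦ (1 + t • A).det) (Icc 0 1) :=
    (ContinuousLinearMap.continuous_det.comp (by fun_prop)).continuousOn
  by_contra! hle
  obtain ⟨t, ht, h0⟩ := intermediate_value_Icc' zero_le_one hcont
    ⟨by simpa only [one_smul] using hle, by simp [ContinuousLinearMap.det]⟩
  exact hne t ht h0

end Interpolation

section Perturbation

open scoped NNReal

theorem LipschitzWith.bijective_id_add {E : Type*} [NormedAddCommGroup E]
    [CompleteSpace E] {g : E → E} {K : ℝ≥0}
    (hg : LipschitzWith K g) (hK : K < 1) : Function.Bijective fun x ↦ x + g x := by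
  have hcontr : ∀ y, ContractingWith K fun x ↦ y - g x := fun y ↦
    ⟨hK, LipschitzWith.of_dist_le_mul fun a b ↦ by
      rw [dist_sub_left]; exact hg.dist_le_mul a b⟩
  refine ⟨fun a b hab ↦ ?_, fun y ↦ ?_⟩
  · refine (hcontr (b + g b)).fixedPoint_unique' ?_ ?_
    · exact sub_eq_of_eq_add hab.symm
    · exact add_sub_cancel_right b (g b)
  · refine ⟨(hcontr y).fixedPoint, ?_⟩
    have := (hcontr y).fixedPoint_isFixedPt
    exact (eq_sub_iff_add_eq.1 this.symm)

variable {E : Type*} [NormedAddCommGroup E] [NormedSpace ℝ E]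

theorem exists_mem_sphere_dist_le {x y : E} {r : ℝ} (hx : ‖x‖ ≤ r) (hy : r ≤ ‖y‖) :
    ∃ z, ‖z‖ = r ∧ dist x z ≤ dist x y := by
  have hc : ContinuousOn (fun t : ℝ ↦ ‖AffineMap.lineMap x y t‖) (Icc 0 1) := by
    refine Continuous.continuousOn ?_
    exact (AffineMap.lineMap_continuous).norm
  obtain ⟨t, ht, hz⟩ := intermediate_value_Icc zero_le_one hc
    (show r ∈ Icc _ _ by simp [hx, hy])
  refine ⟨_, hz, ?_⟩
  rw [dist_left_lineMap, Real.norm_of_nonneg ht.1]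
  exact mul_le_of_le_one_left dist_nonneg ht.2

theorem LipschitzOnWith.indicator_closedBall {F : Type*} [NormedAddCommGroup F] {g : E → F}
    {K : ℝ≥0} {r : ℝ} (hg : LipschitzOnWith K g (closedBall 0 r))
    (h0 : ∀ x, ‖x‖ = r → g x = 0) :
    LipschitzWith K ((closedBall 0 r).indicator g) := by
  have key : ∀ x y : E, ‖x‖ ≤ r → r < ‖y‖ → ‖g x‖ ≤ K * dist x y := by
    intro x y hx hy
    obtain ⟨z, hz, hd⟩ := exists_mem_sphere_dist_le hx hy.le
    have := hg.dist_le_mul x (by simpa using hx) z (by simpa using hz.le)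
    rw [h0 z hz, dist_zero_right] at this
    exact this.trans (by gcongr)
  refine LipschitzWith.of_dist_le_mul fun x y ↦ ?_
  by_cases hx : x ∈ closedBall (0 : E) r <;> by_cases hy : y ∈ closedBall (0 : E) r
  · simpa [indicator_of_mem hx, indicator_of_mem hy] using hg.dist_le_mul x hx y hy
  · rw [indicator_of_mem hx, indicator_of_notMem hy, dist_zero_right]
    exact key x y (by simpa using hx) (by simpa using hy)
  · rw [indicator_of_mem hy, indicator_of_notMem hx, dist_zero_left, dist_comm]
    exact key y x (by simpa using hy) (by simpa using hx)
  · rw [indicator_of_notMem hx, indicator_of_notMem hy, dist_self]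
    positivity

theorem LipschitzOnWith.bijOn_ball_id_add [CompleteSpace E] {g : E → E} {K : ℝ≥0} {r : ℝ}
    (hg : LipschitzOnWith K g (closedBall 0 r)) (hK : K < 1) (h0 : ∀ x, ‖x‖ = r → g x = 0) :
    BijOn (fun x ↦ x + g x) (ball 0 r) (ball 0 r) := by
  have hbij := (hg.indicator_closedBall h0).bijective_id_add hK
  set Φ : E → E := fun x ↦ x + (closedBall 0 r).indicator g x with hΦ
  have heq : EqOn Φ (fun x ↦ x + g x) (ball 0 r) := fun x hx ↦ by
    simp only [hΦ, indicator_of_mem (ball_subset_closedBall hx)]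
  have hid : ∀ x ∉ ball (0 : E) r, Φ x = x := by
    intro x hx
    by_cases hx' : x ∈ closedBall (0 : E) r
    · have : ‖x‖ = r := le_antisymm (by simpa using hx') (by simpa using hx)
      simp [hΦ, indicator_of_mem hx', h0 x this]
    · simp [hΦ, indicator_of_notMem hx']
  refine BijOn.congr ⟨fun x hx ↦ ?_, hbij.1.injOn, fun y hy ↦ ?_⟩ heq
  · by_contra hΦx
    exact hΦx ((hbij.1 (hid _ hΦx)).symm ▸ hx)
  · obtain ⟨x, rfl⟩ := hbij.2 y
    refine ⟨x, ?_, rfl⟩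
    by_contra hx
    exact hx (hid x hx ▸ hy)

end Perturbation

section Volume

variable {E : Type*} [NormedAddCommGroup E] [NormedSpace ℝ E] [FiniteDimensional ℝ E]
  [MeasurableSpace E] [BorelSpace E] (μ : Measure E) [μ.IsAddHaarMeasure]

/-- A `C¹` map of a closed ball that is the identity on the boundary sphere has the same total
signed volume as the identity. -/
theorem setIntegral_ball_det_one_add_fderiv {g : E → E} {r : ℝ}
    (hg : ∀ x ∈ closedBall 0 r, ContDiffAt ℝ 1 g x) (h0 : ∀ x, ‖x‖ = r → g x = 0) :
    ∫ x in ball 0 r, (1 + fderiv ℝ g x).det ∂μ = μ.real (ball 0 r) := by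
  have hcont : ContinuousOn (fderiv ℝ g) (closedBall 0 r) := fun x hx ↦
    ((hg x hx).continuousAt_fderiv one_ne_zero).continuousWithinAt
  obtain ⟨C, hC⟩ := (isCompact_closedBall (0 : E) r).exists_bound_of_continuousOn hcont
  let K : NNReal := C.toNNReal
  have hKb : ∀ x ∈ closedBall (0 : E) r, ‖fderiv ℝ g x‖ ≤ K := fun x hx ↦
    (hC x hx).trans C.le_coe_toNNReal
  have hlip : LipschitzOnWith K g (closedBall 0 r) :=
    (convex_closedBall (0 : E) r).lipschitzOnWith_of_nnnorm_fderiv_le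
      (fun x hx ↦ (hg x hx).differentiableAt one_ne_zero) fun x hx ↦ hKb x hx
  have hdetInt : ∀ t : ℝ, IntegrableOn (fun x ↦ (1 + t • fderiv ℝ g x).det) (ball 0 r) μ := by
    intro t
    refine IntegrableOn.mono_set ?_ ball_subset_closedBall
    refine ContinuousOn.integrableOn_compact (isCompact_closedBall _ _) ?_
    exact ContinuousLinearMap.continuous_det.comp_continuousOn
      (continuousOn_const.add (hcont.const_smul t))
  have hsmall : ∀ t : ℝ, 0 < t → t ≤ (K + 1 : ℝ)⁻¹ →
      ∫ x in ball 0 r, (1 + t • fderiv ℝ g x).det ∂μ = μ.real (ball 0 r) := by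
    intro t ht htK
    have htK1 : t * K < 1 := by
      have : t * (K + 1) ≤ 1 := by
        rwa [← le_div_iff₀ (by positivity), one_div]
      nlinarith
    have hlip' : LipschitzOnWith (t.toNNReal * K) (fun x ↦ t • g x) (closedBall 0 r) :=
      LipschitzOnWith.of_dist_le_mul fun x hx y hy ↦ by
        rw [dist_smul₀, Real.norm_of_nonneg ht.le, NNReal.coe_mul,
          Real.coe_toNNReal t ht.le, mul_assoc]
        exact mul_le_mul_of_nonneg_left (hlip.dist_le_mul x hx y hy) ht.le
    have hb := hlip'.bijOn_ball_id_add (by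
      rwa [← NNReal.coe_lt_coe, NNReal.coe_mul, Real.coe_toNNReal t ht.le])
      fun x hx ↦ by simp [h0 x hx]
    have hder : ∀ x ∈ ball (0 : E) r, HasFDerivWithinAt (fun x ↦ x + t • g x)
        (1 + t • fderiv ℝ g x) (ball 0 r) x := fun x hx ↦
      ((hasFDerivAt_id x).add ((((hg x (ball_subset_closedBall hx)).differentiableAt
        one_ne_zero).hasFDerivAt).const_smul t)).hasFDerivWithinAt
    have hcv := integral_image_eq_integral_abs_det_fderiv_smul μ measurableSet_ball hder hb.injOn
      (fun _ ↦ (1 : ℝ))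
    rw [hb.image_eq, setIntegral_const, smul_eq_mul, mul_one] at hcv
    rw [hcv]
    refine setIntegral_congr_fun measurableSet_ball fun x hx ↦ ?_
    have : ‖t • fderiv ℝ g x‖ < 1 := by
      rw [norm_smul, Real.norm_of_nonneg ht.le]
      exact (mul_le_mul_of_nonneg_left (hKb x (ball_subset_closedBall hx)) ht.le).trans_lt htK1
    simp only [smul_eq_mul, mul_one]
    exact (abs_of_pos (det_one_add_pos this)).symm
  obtain ⟨s, w, hs, hw⟩ := exists_weights_det_one_add (E := E)
    (show (0 : ℝ) < (K + 1 : ℝ)⁻¹ by positivity)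
  have hw1 : ∑ t ∈ s, w t = 1 := by
    simpa [ContinuousLinearMap.det] using (hw 0).symm
  rw [integral_congr_ae (ae_of_all _ fun x ↦ hw (fderiv ℝ g x)),
    integral_finsetSum _ fun t _ ↦ (hdetInt t).const_mul (w t)]
  simp_rw [integral_const_mul]
  rw [Finset.sum_congr rfl fun t ht ↦ by rw [hsmall t (hs t ht).1 (hs t ht).2],
    ← Finset.sum_mul, hw1, one_mul]

end Volume

section Retraction

variable {E : Type*} [NormedAddCommGroup E] [InnerProductSpace ℝ E]

theorem det_fderiv_eq_zero_of_norm_eventually_eq [FiniteDimensional ℝ E] {F : E → E} {x : E}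
    {r : ℝ} (hr : 0 < r)
    (hF : DifferentiableAt ℝ F x) (hn : ∀ᶠ y in nhds x, ‖F y‖ = r) : (fderiv ℝ F x).det = 0 := by
  have hconst : (fun y ↦ ⟪F y, F y⟫) =ᶠ[nhds x] fun _ ↦ r ^ 2 := by
    filter_upwards [hn] with y hy
    rw [real_inner_self_eq_norm_sq, hy]
  have hzero : ∀ v, ⟪F x, fderiv ℝ F x v⟫ = 0 := by
    intro v
    have h1 := (hF.hasFDerivAt.inner ℝ hF.hasFDerivAt).unique
      ((hasFDerivAt_const (r ^ 2) x).congr_of_eventuallyEq hconst)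
    simpa [fderivInnerCLM_apply, real_inner_comm] using DFunLike.congr_fun h1 v
  by_contra hdet
  obtain ⟨v, hv⟩ := (LinearMap.equivOfDetNeZero _ hdet).surjective (F x)
  have hv' : fderiv ℝ F x v = F x := hv
  have := hzero v
  rw [hv', real_inner_self_eq_norm_sq, hn.self_of_nhds] at this
  exact (pow_pos hr 2).ne' this

/-- There is no `C¹` retraction of a closed ball onto its boundary sphere. -/
theorem not_exists_contDiffAt_retraction [FiniteDimensional ℝ E] {r : ℝ} (hr : 0 < r) {F : E → E}
    (hF : ∀ x ∈ closedBall 0 r, ContDiffAt ℝ 1 F x) (hid : ∀ x, ‖x‖ = r → F x = x) :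
    ¬ ∀ x ∈ closedBall 0 r, ‖F x‖ = r := by
  intro hn
  borelize E
  let μ : Measure E := Measure.addHaar
  have hvol := setIntegral_ball_det_one_add_fderiv μ (g := fun x ↦ F x - x) (r := r)
    (fun x hx ↦ (hF x hx).sub contDiffAt_id) fun x hx ↦ by simp [hid x hx]
  have hzero : ∫ x in ball 0 r, (1 + fderiv ℝ (fun x ↦ F x - x) x).det ∂μ = 0 := by
    refine setIntegral_eq_zero_of_forall_eq_zero fun x hx ↦ ?_
    have hd : DifferentiableAt ℝ F x :=
      (hF x (ball_subset_closedBall hx)).differentiableAt one_ne_zero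
    have : 1 + fderiv ℝ (fun x ↦ F x - x) x = fderiv ℝ F x := by
      rw [fderiv_fun_sub hd differentiableAt_fun_id, fderiv_fun_id]
      exact add_sub_cancel _ _
    rw [this]
    refine det_fderiv_eq_zero_of_norm_eventually_eq hr hd ?_
    filter_upwards [isOpen_ball.mem_nhds hx] with y hy using hn y (ball_subset_closedBall hy)
  rw [hzero] at hvol
  exact (ENNReal.toReal_pos (measure_ball_pos μ 0 hr).ne' measure_ball_lt_top.ne).ne hvol

theorem exists_zero_of_contDiff_of_inner_pos [FiniteDimensional ℝ E] {u : E → E} {r : ℝ}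
    (hr : 0 < r) (hu : ContDiff ℝ 1 u) (hpos : ∀ x, ‖x‖ = r → 0 < ⟪u x, x⟫) :
    ∃ x, ‖x‖ ≤ r ∧ u x = 0 := by
  by_contra! hne
  let D : E → ℝ := fun x ↦ ⟪u x, x⟫ ^ 2 + ‖u x‖ ^ 2 * (r ^ 2 - ‖x‖ ^ 2)
  -- the forward intersection of the sphere with the ray from `x` in the direction `u x`
  let s : E → ℝ := fun x ↦ (-⟪u x, x⟫ + √(D x)) / ‖u x‖ ^ 2
  have hu0 : ∀ x ∈ closedBall (0 : E) r, 0 < ‖u x‖ := fun x hx ↦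
    norm_pos_iff.2 (hne x (by simpa using hx))
  have hD : ∀ x ∈ closedBall (0 : E) r, 0 < D x := by
    intro x hx
    have hu := hu0 x hx
    rcases (mem_closedBall_zero_iff.1 hx).lt_or_eq with hlt | heq
    · have : 0 < r ^ 2 - ‖x‖ ^ 2 := by nlinarith [norm_nonneg x]
      positivity
    · have := hpos x heq
      simp only [D, heq, sub_self, mul_zero, add_zero]
      positivity
  have hinner : ContDiff ℝ 1 fun x ↦ ⟪u x, x⟫ := hu.inner ℝ contDiff_id
  have hDs : ContDiff ℝ 1 D :=
    (hinner.pow 2).add ((hu.norm_sq ℝ).mul (contDiff_const.sub (contDiff_id.norm_sq ℝ)))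
  refine not_exists_contDiffAt_retraction hr (F := fun x ↦ x + s x • u x) (fun x hx ↦ ?_)
    (fun x hx ↦ ?_) fun x hx ↦ ?_
  · refine contDiffAt_id.add (ContDiffAt.smul ?_ hu.contDiffAt)
    exact (hinner.contDiffAt.neg.add (hDs.contDiffAt.sqrt (hD x hx).ne')).div
      (hu.norm_sq ℝ).contDiffAt (pow_pos (hu0 x hx) 2).ne'
  · have : s x = 0 := by
      simp only [s, D, hx, sub_self, mul_zero, add_zero, Real.sqrt_sq (hpos x hx).le,
        neg_add_cancel, zero_div]
    simp [this]
  · have h1 : ‖x + s x • u x‖ ^ 2 = r ^ 2 := by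
      have hs : s x * ‖u x‖ ^ 2 = -⟪u x, x⟫ + √(D x) :=
        div_mul_cancel₀ _ (pow_pos (hu0 x hx) 2).ne'
      have hsq : √(D x) ^ 2 = ⟪u x, x⟫ ^ 2 + ‖u x‖ ^ 2 * (r ^ 2 - ‖x‖ ^ 2) :=
        Real.sq_sqrt (hD x hx).le
      rw [norm_add_sq_real, norm_smul, inner_smul_right, mul_pow, Real.norm_eq_abs, sq_abs,
        real_inner_comm]
      refine mul_left_cancel₀ (pow_pos (hu0 x hx) 2).ne' ?_
      have h2 : √(D x) = s x * ‖u x‖ ^ 2 + ⟪u x, x⟫ := by linarith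
      rw [h2] at hsq
      linear_combination hsq
    exact (sq_eq_sq₀ (norm_nonneg _) hr.le).1 h1

theorem exists_norm_lt_of_inner_nonneg [FiniteDimensional ℝ E] {f : E → E} (hf : Continuous f)
    {r ε : ℝ} (hr : 0 < r) (hε : 0 < ε) (h : ∀ x, ‖x‖ = r → 0 ≤ ⟪f x, x⟫) :
    ∃ x, ‖x‖ ≤ r ∧ ‖f x‖ < ε := by
  set δ : ℝ := ε / (2 * r) with hδ
  have hδ0 : 0 < δ := by positivity
  have hδr : δ * r = ε / 2 := by rw [hδ]; field_simp
  obtain ⟨u, hu, hfu, -⟩ := (hf.add (continuous_const_smul δ)).exists_contDiff_approx 1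
    (ε := fun _ ↦ ε / 2) continuous_const fun _ ↦ by positivity
  have hfu' : ∀ x, ‖u x - (f x + δ • x)‖ < ε / 2 := fun x ↦ by
    simpa [dist_eq_norm] using hfu x
  obtain ⟨x, hx, hux⟩ := exists_zero_of_contDiff_of_inner_pos hr hu fun x hx ↦ by
    have h1 : ⟪u x, x⟫ = ⟪u x - (f x + δ • x), x⟫ + ⟪f x, x⟫ + δ * r ^ 2 := by
      rw [inner_sub_left, inner_add_left, real_inner_smul_left, real_inner_self_eq_norm_sq, hx]
      ring
    have h2 := neg_le_of_abs_le (abs_real_inner_le_norm (u x - (f x + δ • x)) x)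
    rw [hx] at h2
    have h3 := mul_lt_mul_of_pos_right (hfu' x) hr
    have h4 := h x hx
    nlinarith
  refine ⟨x, hx, ?_⟩
  have h1 := hfu' x
  rw [hux, zero_sub, norm_neg] at h1
  calc ‖f x‖ = ‖(f x + δ • x) - δ • x‖ := by rw [add_sub_cancel_right]
    _ ≤ ‖f x + δ • x‖ + ‖δ • x‖ := norm_sub_le _ _
    _ < ε / 2 + ε / 2 := by
      refine add_lt_add_of_lt_of_le h1 ?_
      rw [norm_smul, Real.norm_of_nonneg hδ0.le, ← hδr]
      gcongr
    _ = ε := add_halves ε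

end Retraction

/-- The "acute angle" lemma: if a continuous map `f : ℝ^m → ℝ^m` satisfies
`⟪f c, c⟫ ≥ 0` on the sphere of radius `r > 0`, then `f` has a zero in the
closed ball of radius `r`. -/
theorem acute_angle_lemma (m : ℕ) (f : EuclideanSpace ℝ (Fin m) → EuclideanSpace ℝ (Fin m))
    (hf : Continuous f) (r : ℝ) (hr : 0 < r)
    (h : ∀ c : EuclideanSpace ℝ (Fin m), ‖c‖ = r → 0 ≤ ⟪f c, c⟫) :
    ∃ c₀ : EuclideanSpace ℝ (Fin m), ‖c₀‖ ≤ r ∧ f c₀ = 0 := by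
  obtain ⟨c₀, hc₀, hmin⟩ := (isCompact_closedBall (0 : EuclideanSpace ℝ (Fin m)) r).exists_isMinOn
    (nonempty_closedBall.2 hr.le) hf.norm.continuousOn
  refine ⟨c₀, by simpa using hc₀, ?_⟩
  by_contra hne
  obtain ⟨x, hx, hlt⟩ := exists_norm_lt_of_inner_nonneg hf hr (norm_pos_iff.2 hne) h
  exact hlt.not_ge (hmin (show x ∈ closedBall _ _ by simpa using hx))
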